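/- Let 1 ≤ l < k ≤ n, τ = 1/(k−l), α > 0, λ ∈ Γ̃_k, and ξ ∈ ℝⁿ. Write S_k' = Σ_p S_k^{pp}(λ)ξ_p, S_l' = Σ_p S_l^{pp}(λ)ξ_p, Q_k = Σ_{p≠q} S_k^{pp,qq}(λ)ξ_pξ_q, and Q_l = Σ_{p≠q} S_l^{pp,qq}(λ)ξ_pξ_q. Then: (i) −Q_k/S_k(λ) + Q_l/S_l(λ) ≥ (S_k'/S_k(λ) − S_l'/S_l(λ)) · ((τ−1)S_k'/S_k(λ) − (τ+1)S_l'/S_l(λ)); and (ii) for every δ > 0, −Q_k + (1 − τ + τ/δ)(S_k')²/S_k(λ) ≥ S_k(λ)(1 + τ − δτ)(S_l'/S_l(λ))² − (S_k(λ)/S_l(λ)) · Q_l. -/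

import Mathlib

open scoped BigOperators

noncomputable section

/-- The `j`-th elementary symmetric function of the entries of `lam` indexed by `T`
(`j : ℤ`, with value `0` for `j < 0`). -/
def sigmaOn {n : ℕ} (T : Finset (Fin n)) (j : ℤ) (lam : Fin n → ℝ) : ℝ :=
  if 0 ≤ j then ∑ s ∈ T.powersetCard j.toNat, ∏ i ∈ s, lam i else 0

/-- The `j`-th elementary symmetric polynomial `σ_j(λ)`. -/
def esymmR {n : ℕ} (j : ℤ) (lam : Fin n → ℝ) : ℝ := sigmaOn Finset.univ j lam

/-- The Garding cone `Γ_k`. -/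
def GammaCone (n k : ℕ) : Set (Fin n → ℝ) :=
  {lam | ∀ i : ℕ, 1 ≤ i → i ≤ k → 0 < esymmR (i : ℤ) lam}

/-- `S_j(λ) = σ_j(λ) + α σ_{j-1}(λ)`. -/
def Sfun {n : ℕ} (α : ℝ) (j : ℤ) (lam : Fin n → ℝ) : ℝ :=
  esymmR j lam + α * esymmR (j - 1) lam

/-- The cone `Γ̃_k = Γ_{k-1} ∩ {λ : S_k(λ) > 0}`. -/
def GammaTilde (n k : ℕ) (α : ℝ) : Set (Fin n → ℝ) :=
  GammaCone n (k - 1) ∩ {lam | 0 < Sfun α (k : ℤ) lam}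

/-- `S_k^{pp}(λ) = σ_{k-1}(λ|p) + α σ_{k-2}(λ|p)`, where `(λ|p)` deletes the
`p`-th entry of `λ`. -/
def SD {n : ℕ} (α : ℝ) (k : ℤ) (lam : Fin n → ℝ) (p : Fin n) : ℝ :=
  sigmaOn (Finset.univ.erase p) (k - 1) lam + α * sigmaOn (Finset.univ.erase p) (k - 2) lam

/-- `S_k^{pp,qq}(λ) = σ_{k-2}(λ|pq) + α σ_{k-3}(λ|pq)` for `p ≠ q`, where `(λ|pq)`
deletes the `p`-th and `q`-th entries of `λ`. -/
def SDD {n : ℕ} (α : ℝ) (k : ℤ) (lam : Fin n → ℝ) (p q : Fin n) : ℝ :=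
  sigmaOn ((Finset.univ.erase p).erase q) (k - 2) lam
    + α * sigmaOn ((Finset.univ.erase p).erase q) (k - 3) lam

/-- `S_k' = Σ_p S_k^{pp}(λ) ξ_p`. -/
def Sprime {n : ℕ} (α : ℝ) (k : ℤ) (lam ξ : Fin n → ℝ) : ℝ :=
  ∑ p, SD α k lam p * ξ p

/-- `Q_k = Σ_{p ≠ q} S_k^{pp,qq}(λ) ξ_p ξ_q`. -/
def Qform {n : ℕ} (α : ℝ) (k : ℤ) (lam ξ : Fin n → ℝ) : ℝ :=
  ∑ p, ∑ q ∈ Finset.univ.erase p, SDD α k lam p q * ξ p * ξ q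

/-- elementary symmetric sums over an arbitrary index type -/
def es {ι : Type*} (T : Finset ι) (j : ℤ) (x : ι → ℝ) : ℝ :=
  if 0 ≤ j then ∑ s ∈ T.powersetCard j.toNat, ∏ i ∈ s, x i else 0

theorem es_zero {ι : Type*} (T : Finset ι) (x : ι → ℝ) : es T 0 x = 1 := by
  simp [es]

theorem es_neg {ι : Type*} (T : Finset ι) (j : ℤ) (hj : j < 0) (x : ι → ℝ) : es T j x = 0 := by
  simp [es, not_le.mpr hj]

theorem es_nat {ι : Type*} (T : Finset ι) (j : ℕ) (x : ι → ℝ) :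
    es T (j : ℤ) x = ∑ s ∈ T.powersetCard j, ∏ i ∈ s, x i := by
  simp [es]

theorem es_empty {ι : Type*} (j : ℤ) (hj : j ≠ 0) (x : ι → ℝ) :
    es (∅ : Finset ι) j x = 0 := by
  rcases lt_or_ge j 0 with h | h
  · exact es_neg _ _ h _
  · obtain ⟨m, rfl⟩ := Int.eq_ofNat_of_zero_le h
    rw [es_nat, Finset.powersetCard_eq_empty.mpr]
    · simp
    · simp only [Finset.card_empty]; omega

theorem es_insert {ι : Type*} [DecidableEq ι] {T : Finset ι} {i : ι} (hi : i ∉ T) (j : ℤ)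
    (x : ι → ℝ) : es (insert i T) j x = es T j x + x i * es T (j - 1) x := by
  rcases lt_trichotomy j 0 with h | h | h
  · rw [es_neg _ _ h, es_neg _ _ h, es_neg _ _ (by omega)]; simp
  · subst h
    rw [es_zero, es_zero, es_neg _ _ (by omega)]; simp
  · obtain ⟨m, rfl⟩ : ∃ m : ℕ, j = (m : ℤ) + 1 := ⟨(j - 1).toNat, by omega⟩
    have e1 : ((m : ℤ) + 1 - 1) = (m : ℤ) := by ring
    rw [e1]
    have e2 : ((m : ℤ) + 1) = ((m + 1 : ℕ) : ℤ) := by push_cast; ring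
    rw [e2, es_nat, es_nat, es_nat, Finset.powersetCard_succ_insert hi, Finset.sum_union,
      Finset.sum_image, Finset.mul_sum]
    · congr 1
      apply Finset.sum_congr rfl
      intro s hs
      rw [Finset.prod_insert]
      exact fun h => hi ((Finset.mem_powersetCard.mp hs).1 h)
    · intro s hs t ht hst
      have hs' : i ∉ s := fun h => hi ((Finset.mem_powersetCard.mp hs).1 h)
      have ht' : i ∉ t := fun h => hi ((Finset.mem_powersetCard.mp ht).1 h)
      rw [← Finset.erase_insert hs', ← Finset.erase_insert ht']
      exact congrArg (fun u => Finset.erase u i) hst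
    · rw [Finset.disjoint_left]
      intro s hs hs2
      obtain ⟨t, ht, rfl⟩ := Finset.mem_image.mp hs2
      exact hi ((Finset.mem_powersetCard.mp hs).1 (Finset.mem_insert_self _ _))

theorem es_erase {ι : Type*} [DecidableEq ι] {T : Finset ι} {i : ι} (hi : i ∈ T) (j : ℤ)
    (x : ι → ℝ) : es T j x = es (T.erase i) j x + x i * es (T.erase i) (j - 1) x := by
  rw [← es_insert (Finset.notMem_erase i T), Finset.insert_erase hi]

theorem es_map {ι κ : Type*} (f : ι ↪ κ) (T : Finset ι) (j : ℤ) (x : κ → ℝ) :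
    es (T.map f) j x = es T j (fun i => x (f i)) := by
  unfold es
  split_ifs
  · rw [Finset.powersetCard_map, Finset.sum_map]
    simp
  · rfl

theorem es_euler {ι : Type*} [DecidableEq ι] (T : Finset ι) (x : ι → ℝ) :
    ∀ j : ℤ, ∑ i ∈ T, x i * es (T.erase i) (j - 1) x = j * es T j x := by
  induction T using Finset.induction_on with
  | empty =>
    intro j
    by_cases h : j = 0
    · simp [h]
    · simp [es_empty j h]
  | insert i T hi ih =>
    intro j
    rw [Finset.sum_insert hi, Finset.erase_insert hi]
    have : ∀ p ∈ T, x p * es ((insert i T).erase p) (j - 1) x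
        = x p * es (T.erase p) (j - 1) x + x i * (x p * es (T.erase p) (j - 1 - 1) x) := by
      intro p hp
      have hne : i ≠ p := fun h => hi (h ▸ hp)
      rw [Finset.erase_insert_of_ne hne,
        es_insert (fun h => hi (Finset.mem_of_mem_erase h))]
      ring
    rw [Finset.sum_congr rfl this, Finset.sum_add_distrib, ← Finset.mul_sum, ih, ih,
      es_insert hi]
    push_cast
    ring

theorem es_hasDerivAt {ι : Type*} [DecidableEq ι] (T : Finset ι) (x ξ : ι → ℝ) (t : ℝ) :
    ∀ j : ℤ, HasDerivAt (fun s : ℝ => es T j (fun i => x i + s * ξ i))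
      (∑ p ∈ T, es (T.erase p) (j - 1) (fun i => x i + t * ξ i) * ξ p) t := by
  induction T using Finset.induction_on with
  | empty =>
    intro j
    by_cases h : j = 0
    · simpa [h, es_zero] using hasDerivAt_const t (1 : ℝ)
    · simpa [es_empty j h] using hasDerivAt_const t (0 : ℝ)
  | insert i T hi ih =>
    intro j
    simp only [es_insert hi]
    have h1 : HasDerivAt (fun s : ℝ => x i + s * ξ i) (ξ i) t := by
      simpa using ((hasDerivAt_id t).mul_const (ξ i)).const_add (x i)
    refine ((ih j).add (h1.mul (ih (j - 1)))).congr_deriv ?_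
    rw [Finset.sum_insert hi, Finset.erase_insert hi]
    have : ∀ p ∈ T, es ((insert i T).erase p) (j - 1) (fun i => x i + t * ξ i) * ξ p
        = es (T.erase p) (j - 1) (fun i => x i + t * ξ i) * ξ p
          + (x i + t * ξ i) * (es (T.erase p) (j - 1 - 1) (fun i => x i + t * ξ i) * ξ p) := by
      intro p hp
      have hne : i ≠ p := fun h => hi (h ▸ hp)
      rw [Finset.erase_insert_of_ne hne,
        es_insert (fun h => hi (Finset.mem_of_mem_erase h))]
      ring
    rw [Finset.sum_congr rfl this, Finset.sum_add_distrib, ← Finset.mul_sum]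
    ring

open Polynomial in
theorem splits_derivative_real {f : ℝ[X]} (hf : f.Splits) : (derivative f).Splits := by
  rw [splits_iff_card_roots] at *
  have h1 := card_roots_le_derivative f
  have h2 := card_roots' (derivative f)
  have h3 := natDegree_derivative_le f
  by_cases h0 : f.natDegree = 0
  · omega
  · omega

open Polynomial in
theorem splits_newton {f : ℝ[X]} (hf : f.Splits) (a : ℝ) :
    f.eval a * (derivative (derivative f)).eval a ≤ ((derivative f).eval a) ^ 2 := by
  have key : ∀ s : Multiset ℝ, ∀ g : ℝ[X], g = (s.map (fun r => X - C r)).prod →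
      g.eval a * (derivative (derivative g)).eval a ≤ ((derivative g).eval a) ^ 2 := by
    intro s
    induction s using Multiset.induction_on with
    | empty => intro g hg; simp [hg]
    | cons r s ih =>
      intro g hg
      have h := ih _ rfl
      rw [Multiset.map_cons, Multiset.prod_cons] at hg
      generalize (s.map (fun r => X - C r)).prod = p at h hg
      subst hg
      simp only [derivative_mul, derivative_add, derivative_sub, derivative_X, derivative_C,
        eval_add, eval_mul, eval_sub, eval_X, eval_C, sub_zero, one_mul]
      nlinarith [mul_nonneg (sq_nonneg (a - r)) (sub_nonneg.mpr h), sq_nonneg (p.eval a)]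
  have h := key f.roots _ rfl
  have hf' := hf.eq_prod_roots
  generalize (f.roots.map (fun r => X - C r)).prod = p at h hf'
  rw [hf']
  simp only [derivative_mul, derivative_C, zero_mul, zero_add, eval_mul, eval_C]
  nlinarith [mul_nonneg (sq_nonneg f.leadingCoeff) (sub_nonneg.mpr h)]

open Polynomial in
theorem es_newton {ι : Type*} (T : Finset ι) (x : ι → ℝ) (j : ℕ) :
    es T (j : ℤ) x * es T ((j + 2 : ℕ) : ℤ) x ≤ (es T ((j + 1 : ℕ) : ℤ) x) ^ 2 := by
  simp only [es_nat, ← Finset.esymm_map_val]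
  set s := Multiset.map x T.val with hs
  rcases le_or_gt (j + 2) (Multiset.card s) with h | h
  · set d := Multiset.card s - (j + 2) with hd
    set p := (s.map fun r => X + C r).prod with hp
    have hsp : p.Splits := by
      rw [hp]
      apply Splits.multisetProd
      intro f hf
      obtain ⟨r, -, rfl⟩ := Multiset.mem_map.mp hf
      exact Splits.X_add_C r
    have hsp' : (derivative^[d] p).Splits := by
      clear_value d
      clear hd
      induction d with
      | zero => exact hsp
      | succ d ih => rw [Function.iterate_succ_apply']; exact splits_derivative_real ih
    have hN := splits_newton hsp' 0
    rw [← Function.iterate_succ_apply' derivative, ← Function.iterate_succ_apply' derivative,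
      ← coeff_zero_eq_eval_zero, ← coeff_zero_eq_eval_zero, ← coeff_zero_eq_eval_zero,
      coeff_iterate_derivative, coeff_iterate_derivative, coeff_iterate_derivative] at hN
    simp only [zero_add, Nat.descFactorial_self, nsmul_eq_mul] at hN
    rw [hp, Multiset.prod_X_add_C_coeff _ (by omega), Multiset.prod_X_add_C_coeff _ (by omega),
      Multiset.prod_X_add_C_coeff _ (by omega)] at hN
    rw [show Multiset.card s - d = j + 2 by omega, show Multiset.card s - (d+1) = j + 1 by omega,
      show Multiset.card s - (d+1+1) = j by omega] at hN
    rw [Nat.factorial_succ (d+1), Nat.factorial_succ d] at hN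
    push_cast at hN
    have hd0 : (0:ℝ) < (d.factorial : ℝ) := by positivity
    generalize (d.factorial : ℝ) = F at *
    generalize s.esymm j = u at *
    generalize s.esymm (j+1) = v at *
    generalize s.esymm (j+2) = w at *
    have hdd : (0:ℝ) ≤ (d:ℝ) := by positivity
    generalize (d:ℝ) = D at *
    have h2 : (F^2*(D+1)) * ((D+2) * (u * w)) ≤ (F^2 * (D+1)) * ((D+1) * v^2) := by nlinarith
    have h3 := le_of_mul_le_mul_left h2 (by positivity)
    by_contra hc
    push Not at hc
    nlinarith [sq_nonneg v]
  · have : s.esymm (j + 2) = 0 := by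
      simp [Multiset.esymm, Multiset.powersetCard_eq_empty _ h]
    rw [this]; simp; positivity

/-- Garding cone over a finite index set -/
def Gam {ι : Type*} (T : Finset ι) (k : ℕ) (x : ι → ℝ) : Prop :=
  ∀ i : ℕ, i ≤ k → 0 < es T (i : ℤ) x

theorem Gam.mono {ι : Type*} {T : Finset ι} {k m : ℕ} {x : ι → ℝ} (h : Gam T k x) (hm : m ≤ k) :
    Gam T m x := fun i hi => h i (hi.trans hm)

theorem Gam.erase {ι : Type*} [DecidableEq ι] {T : Finset ι} {i : ι} (hi : i ∈ T) {x : ι → ℝ} :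
    ∀ k : ℕ, Gam T (k + 1) x → Gam (T.erase i) k x := by
  intro k
  induction k with
  | zero =>
    intro _ m hm
    obtain rfl : m = 0 := by omega
    simp [es_zero]
  | succ k ih =>
    intro h m hm
    have h0 := ih (h.mono (by omega))
    rcases Nat.lt_or_ge m (k + 1) with hlt | hge
    · exact h0 m (by omega)
    obtain rfl : m = k + 1 := by omega
    have hN := es_newton (T.erase i) x k
    have e1 := es_erase hi ((k + 1 : ℕ) : ℤ) x
    have e2 := es_erase hi ((k + 2 : ℕ) : ℤ) x
    rw [show ((k + 1 : ℕ) : ℤ) - 1 = (k : ℤ) by push_cast; ring] at e1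
    rw [show ((k + 2 : ℕ) : ℤ) - 1 = ((k + 1 : ℕ) : ℤ) by push_cast; ring] at e2
    have p1 := h (k + 1) (by omega)
    have p2 := h (k + 2) (by omega)
    have p0 := h0 k le_rfl
    rw [e1] at p1
    rw [e2] at p2
    generalize es (T.erase i) (k : ℤ) x = u at *
    generalize es (T.erase i) ((k + 1 : ℕ) : ℤ) x = v at *
    generalize es (T.erase i) ((k + 2 : ℕ) : ℤ) x = w at *
    by_contra hv
    push Not at hv
    have hx : 0 < x i := by
      by_contra hc
      push Not at hc
      nlinarith
    have hw : 0 < w + x i * v := p2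
    have hw0 : x i * v ≤ 0 := by nlinarith
    -- u * w > u * x_i * (-v) ≥ v^2
    have h1 : 0 < u * (w + x i * v) := mul_pos p0 hw
    have h2 : 0 ≤ (v + x i * u) * (-v) := mul_nonneg p1.le (by linarith)
    nlinarith

theorem sq_div_add_le {a b u v : ℝ} (hu : 0 < u) (hv : 0 < v) :
    (a + b) ^ 2 / (u + v) ≤ a ^ 2 / u + b ^ 2 / v := by
  rw [div_add_div _ _ hu.ne' hv.ne', div_le_div_iff₀ (by positivity) (by positivity)]
  nlinarith [sq_nonneg (a * v - b * u)]

theorem quot_formula {ι : Type*} [DecidableEq ι] (T : Finset ι) (x : ι → ℝ) (j : ℕ)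
    (h1 : 0 < es T ((j + 1 : ℕ) : ℤ) x) (h2 : ∀ i ∈ T, 0 < es (T.erase i) (j : ℤ) x) :
    ((j : ℝ) + 2) * (es T ((j + 2 : ℕ) : ℤ) x / es T ((j + 1 : ℕ) : ℤ) x)
      = ∑ i ∈ T, (x i - x i ^ 2 /
          (x i + es (T.erase i) ((j + 1 : ℕ) : ℤ) x / es (T.erase i) (j : ℤ) x)) := by
  have he := es_euler T x ((j + 2 : ℕ) : ℤ)
  rw [← mul_div_assoc, eq_comm, eq_div_iff h1.ne', Finset.sum_mul]
  push_cast at he ⊢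
  rw [← he]
  apply Finset.sum_congr rfl
  intro i hi
  have e1 := es_erase hi ((j + 1 : ℕ) : ℤ) x
  rw [show ((j + 1 : ℕ) : ℤ) - 1 = (j : ℤ) by push_cast; ring] at e1
  rw [show (j : ℤ) + 2 - 1 = (j : ℤ) + 1 by ring]
  have hp := h2 i hi
  push_cast at e1 h1
  rw [e1] at h1 ⊢
  generalize es (T.erase i) (j : ℤ) x = u at *
  generalize es (T.erase i) ((j : ℤ) + 1) x = v at *
  have : x i + v / u = (v + x i * u) / u := by field_simp; ring
  rw [this]
  field_simp
  ring

theorem quot_superadd {ι : Type*} [DecidableEq ι] (j : ℕ) : ∀ (T : Finset ι) (x y : ι → ℝ),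
    Gam T (j + 1) x → Gam T (j + 1) y →
    Gam T (j + 1) (fun i => x i + y i) ∧
    es T ((j + 1 : ℕ) : ℤ) x / es T (j : ℤ) x + es T ((j + 1 : ℕ) : ℤ) y / es T (j : ℤ) y
      ≤ es T ((j + 1 : ℕ) : ℤ) (fun i => x i + y i) / es T (j : ℤ) (fun i => x i + y i) := by
  induction j with
  | zero =>
    intro T x y hx hy
    have e : ∀ z : ι → ℝ, es T 1 z = ∑ i ∈ T, z i := by
      intro z
      have := es_euler T z 1
      simpa [es_zero] using this.symm
    have hx1 := hx 1 le_rfl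
    have hy1 := hy 1 le_rfl
    simp only [Nat.cast_one, e] at hx1 hy1
    constructor
    · intro i hi
      rcases Nat.lt_or_ge i 1 with h | h
      · obtain rfl : i = 0 := by omega
        simp [es_zero]
      · obtain rfl : i = 1 := by omega
        simp only [Nat.cast_one, e, Finset.sum_add_distrib]
        linarith
    · simp [es_zero, e, Finset.sum_add_distrib]
  | succ j ih =>
    intro T x y hx hy
    have hz := (ih T x y (hx.mono (by omega)) (hy.mono (by omega))).1
    have hxe : ∀ i ∈ T, Gam (T.erase i) (j + 1) x := fun i hi => hx.erase hi
    have hye : ∀ i ∈ T, Gam (T.erase i) (j + 1) y := fun i hi => hy.erase hi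
    have hxe0 : ∀ i ∈ T, 0 < es (T.erase i) (j : ℤ) x := fun i hi => hxe i hi j (by omega)
    have hye0 : ∀ i ∈ T, 0 < es (T.erase i) (j : ℤ) y := fun i hi => hye i hi j (by omega)
    have hze0 : ∀ i ∈ T, 0 < es (T.erase i) (j : ℤ) (fun i => x i + y i) :=
      fun i hi => (ih (T.erase i) x y (hxe i hi) (hye i hi)).1 j (by omega)
    have fx := quot_formula T x j (hx _ (by omega)) hxe0
    have fy := quot_formula T y j (hy _ (by omega)) hye0
    have fz := quot_formula T (fun i => x i + y i) j (hz _ (by omega)) hze0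
    have main : es T ((j + 2 : ℕ) : ℤ) x / es T ((j + 1 : ℕ) : ℤ) x
          + es T ((j + 2 : ℕ) : ℤ) y / es T ((j + 1 : ℕ) : ℤ) y
        ≤ es T ((j + 2 : ℕ) : ℤ) (fun i => x i + y i)
          / es T ((j + 1 : ℕ) : ℤ) (fun i => x i + y i) := by
      have hj : (0 : ℝ) < (j : ℝ) + 2 := by positivity
      refine le_of_mul_le_mul_left ?_ hj
      rw [mul_add, fx, fy, fz, ← Finset.sum_add_distrib]
      apply Finset.sum_le_sum
      intro i hi
      have hq := (ih (T.erase i) x y (hxe i hi) (hye i hi)).2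
      have pos : ∀ z : ι → ℝ, Gam T (j + 2) z →
          0 < z i + es (T.erase i) ((j + 1 : ℕ) : ℤ) z / es (T.erase i) (j : ℤ) z := by
        intro z hzz
        have hu : 0 < es (T.erase i) (j : ℤ) z := Gam.erase hi _ hzz j (by omega)
        have e1 := es_erase hi ((j + 1 : ℕ) : ℤ) z
        rw [show ((j + 1 : ℕ) : ℤ) - 1 = (j : ℤ) by push_cast; ring] at e1
        have hp := hzz (j + 1) (by omega)
        rw [e1] at hp
        have : z i + es (T.erase i) ((j + 1 : ℕ) : ℤ) z / es (T.erase i) (j : ℤ) z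
          = (es (T.erase i) ((j + 1 : ℕ) : ℤ) z + z i * es (T.erase i) (j : ℤ) z)
            / es (T.erase i) (j : ℤ) z := by
          field_simp; ring
        rw [this]
        exact div_pos hp hu
      have px := pos x hx
      have py := pos y hy
      have h1 := sq_div_add_le (a := x i) (b := y i) px py
      have h2 : (x i + y i) ^ 2 / (x i + y i
            + es (T.erase i) ((j + 1 : ℕ) : ℤ) (fun i => x i + y i)
              / es (T.erase i) (j : ℤ) (fun i => x i + y i))
          ≤ (x i + y i) ^ 2 /
            ((x i + es (T.erase i) ((j + 1 : ℕ) : ℤ) x / es (T.erase i) (j : ℤ) x)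
            + (y i + es (T.erase i) ((j + 1 : ℕ) : ℤ) y / es (T.erase i) (j : ℤ) y)) := by
        apply div_le_div_of_nonneg_left (sq_nonneg _) (by linarith) (by linarith)
      linarith
    refine ⟨?_, main⟩
    intro m hm
    rcases Nat.lt_or_ge m (j + 2) with h | h
    · exact hz m (by omega)
    · obtain rfl : m = j + 2 := by omega
      have h1 : 0 < es T ((j + 2 : ℕ) : ℤ) x / es T ((j + 1 : ℕ) : ℤ) x :=
        div_pos (hx _ (by omega)) (hx _ (by omega))
      have h2 : 0 < es T ((j + 2 : ℕ) : ℤ) y / es T ((j + 1 : ℕ) : ℤ) y :=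
        div_pos (hy _ (by omega)) (hy _ (by omega))
      have h3 := lt_of_lt_of_le (add_pos h1 h2) main
      have h4 := hz (j + 1) le_rfl
      by_contra hc
      push Not at hc
      exact absurd (div_nonpos_of_nonpos_of_nonneg hc h4.le) (not_le.mpr h3)

theorem es_smul {ι : Type*} (T : Finset ι) (c : ℝ) (j : ℕ) (x : ι → ℝ) :
    es T (j : ℤ) (fun i => c * x i) = c ^ j * es T (j : ℤ) x := by
  rw [es_nat, es_nat, Finset.mul_sum]
  apply Finset.sum_congr rfl
  intro s hs
  rw [Finset.prod_mul_distrib, Finset.prod_const, (Finset.mem_powersetCard.mp hs).2]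

open Topology Filter in
theorem second_test {f f' : ℝ → ℝ} {f'' : ℝ} (h1 : ∀ᶠ t in 𝓝 (0 : ℝ), HasDerivAt f (f' t) t)
    (h2 : HasDerivAt f' f'' 0) (h : ∀ᶠ t in 𝓝 (0 : ℝ), f t + f (-t) ≤ 2 * f 0) : f'' ≤ 0 := by
  by_contra hc
  push Not at hc
  have hneg : Tendsto (fun t : ℝ => -t) (𝓝 0) (𝓝 0) := by
    simpa using (continuous_neg.tendsto (0 : ℝ))
  have h1' := hneg.eventually h1
  have hG : ∀ᶠ t in 𝓝 (0 : ℝ), HasDerivAt (fun t => f t + f (-t)) (f' t - f' (-t)) t := by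
    filter_upwards [h1, h1'] with t a b
    have := a.add (HasDerivAt.comp t b (hasDerivAt_neg t))
    refine this.congr_deriv ?_
    ring
  have hd : deriv (fun t => f t + f (-t)) =ᶠ[𝓝 0] fun t => f' t - f' (-t) :=
    hG.mono fun t ht => ht.deriv
  have hG2 : HasDerivAt (fun t => f' t - f' (-t)) (2 * f'') 0 := by
    have h2' : HasDerivAt f' f'' (-0) := by simpa using h2
    have := h2.sub (HasDerivAt.comp (0 : ℝ) h2' (hasDerivAt_neg 0))
    refine this.congr_deriv ?_
    ring
  have hdd : deriv (deriv (fun t => f t + f (-t))) 0 = 2 * f'' := by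
    rw [hd.deriv_eq]; exact hG2.deriv
  have hmin := isLocalMin_of_deriv_deriv_pos (f := fun t => f t + f (-t)) (x₀ := 0)
    (by rw [hdd]; linarith) (by rw [hd.eq_of_nhds]; simp) (hG.self_of_nhds).continuousAt
  have hconst : (fun t => f t + f (-t)) =ᶠ[𝓝 0] fun _ => 2 * f 0 := by
    filter_upwards [hmin, h] with t a b
    have a' : f 0 + f (-0) ≤ f t + f (-t) := a
    rw [neg_zero] at a'
    linarith
  have : deriv (deriv (fun t => f t + f (-t))) 0 = 0 := by
    rw [hconst.deriv.deriv_eq]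
    simp
  linarith

open Topology Filter in
theorem quot_second {N N' P P' : ℝ → ℝ} {N'' P'' : ℝ} (hN : ∀ t, HasDerivAt N (N' t) t)
    (hN' : HasDerivAt N' N'' 0) (hP : ∀ t, HasDerivAt P (P' t) t) (hP' : HasDerivAt P' P'' 0)
    (hP0 : 0 < P 0) (hN0 : 0 < N 0)
    (h : ∀ᶠ t in 𝓝 (0 : ℝ), N t / P t + N (-t) / P (-t) ≤ 2 * (N 0 / P 0)) :
    N'' / N 0 - P'' / P 0 ≤ 2 * (N' 0 / N 0) * (P' 0 / P 0) - 2 * (P' 0 / P 0) ^ 2 := by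
  have hPe : ∀ᶠ t in 𝓝 (0 : ℝ), P t ≠ 0 :=
    (hP 0).continuousAt.eventually_ne hP0.ne'
  have h2 : HasDerivAt (fun t => (N' t * P t - N t * P' t) / P t ^ 2) _ 0 :=
    ((hN'.mul (hP 0)).sub ((hN 0).mul hP')).div ((hP 0).pow 2) (by positivity)
  have := second_test (f := fun t => N t / P t) (hPe.mono fun t ht => (hN t).div (hP t) ht) h2 h
  simp only [Pi.mul_apply, Pi.sub_apply] at this
  have hk : N'' / N 0 - P'' / P 0 - (2 * (N' 0 / N 0) * (P' 0 / P 0) - 2 * (P' 0 / P 0) ^ 2)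
    = (((N'' * P 0 + N' 0 * P' 0 - (N' 0 * P' 0 + N 0 * P'')) * P 0 ^ 2
        - (N' 0 * P 0 - N 0 * P' 0) * (2 * P 0 * P' 0)) / (P 0 ^ 2) ^ 2) * (P 0 / N 0) := by
    field_simp
    ring
  have h3 : (((N'' * P 0 + N' 0 * P' 0 - (N' 0 * P' 0 + N 0 * P'')) * P 0 ^ 2
        - (N' 0 * P 0 - N 0 * P' 0) * (2 * P 0 * P' 0)) / (P 0 ^ 2) ^ 2) ≤ 0 := by
    convert this using 2
    norm_num
  have h4 := mul_nonpos_of_nonpos_of_nonneg h3 (div_pos hP0 hN0).le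
  linarith

/-- the vector (λ, α) -/
def extVec {n : ℕ} (α : ℝ) (x : Fin n → ℝ) : Option (Fin n) → ℝ := fun o => o.elim α x

/-- the full index set -/
def TT (n : ℕ) : Finset (Option (Fin n)) :=
  insert none ((Finset.univ : Finset (Fin n)).map Function.Embedding.some)

theorem Sfun_eq {n : ℕ} (α : ℝ) (j : ℤ) (x : Fin n → ℝ) :
    Sfun α j x = es (TT n) j (extVec α x) := by
  rw [TT, es_insert (by simp), es_map, es_map]
  rfl

theorem Sfun_hasDerivAt {n : ℕ} (α : ℝ) (j : ℤ) (x ξ : Fin n → ℝ) (t : ℝ) :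
    HasDerivAt (fun s : ℝ => Sfun α j (fun i => x i + s * ξ i))
      (Sprime α j (fun i => x i + t * ξ i) ξ) t := by
  have h := (es_hasDerivAt Finset.univ x ξ t j).add
    ((es_hasDerivAt Finset.univ x ξ t (j - 1)).const_mul α)
  refine h.congr_deriv ?_
  rw [Finset.mul_sum, ← Finset.sum_add_distrib, Sprime]
  apply Finset.sum_congr rfl
  intro p _
  rw [SD, show j - 1 - 1 = j - 2 by ring]
  change es _ _ _ * ξ p + α * (es _ _ _ * ξ p) = (es _ _ _ + α * es _ _ _) * ξ p
  ring

theorem Sprime_hasDerivAt {n : ℕ} (α : ℝ) (j : ℤ) (x ξ : Fin n → ℝ) (t : ℝ) :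
    HasDerivAt (fun s : ℝ => Sprime α j (fun i => x i + s * ξ i) ξ)
      (Qform α j (fun i => x i + t * ξ i) ξ) t := by
  unfold Sprime
  have h : ∀ p ∈ (Finset.univ : Finset (Fin n)),
      HasDerivAt (fun s : ℝ => SD α j (fun i => x i + s * ξ i) p * ξ p)
        (∑ q ∈ Finset.univ.erase p, SDD α j (fun i => x i + t * ξ i) p q * ξ p * ξ q) t := by
    intro p _
    have h := ((es_hasDerivAt (Finset.univ.erase p) x ξ t (j - 1)).add
      ((es_hasDerivAt (Finset.univ.erase p) x ξ t (j - 2)).const_mul α)).mul_const (ξ p)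
    refine h.congr_deriv ?_
    rw [Finset.mul_sum, ← Finset.sum_add_distrib, Finset.sum_mul]
    apply Finset.sum_congr rfl
    intro q _
    rw [SDD, show j - 1 - 1 = j - 2 by ring, show j - 2 - 1 = j - 3 by ring]
    change (es _ _ _ * ξ q + α * (es _ _ _ * ξ q)) * ξ p
      = (es _ _ _ + α * es _ _ _) * ξ p * ξ q
    ring
  exact HasDerivAt.fun_sum h

open Topology Filter in
theorem step_ineq {n : ℕ} (α : ℝ) (x ξ : Fin n → ℝ) (j : ℕ)
    (hx : Gam (TT n) (j + 1) (extVec α x)) :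
    Qform α ((j + 1 : ℕ) : ℤ) x ξ / Sfun α ((j + 1 : ℕ) : ℤ) x
        - Qform α (j : ℤ) x ξ / Sfun α (j : ℤ) x
      ≤ 2 * (Sprime α ((j + 1 : ℕ) : ℤ) x ξ / Sfun α ((j + 1 : ℕ) : ℤ) x)
          * (Sprime α (j : ℤ) x ξ / Sfun α (j : ℤ) x)
        - 2 * (Sprime α (j : ℤ) x ξ / Sfun α (j : ℤ) x) ^ 2 := by
  have z : (fun i => x i + 0 * ξ i) = x := by funext i; ring
  have hcone : ∀ᶠ t in 𝓝 (0 : ℝ), Gam (TT n) (j + 1) (extVec α (fun i => x i + t * ξ i)) := by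
    have : ∀ᶠ t in 𝓝 (0 : ℝ), ∀ m ∈ Finset.range (j + 2),
        0 < Sfun α (m : ℤ) (fun i => x i + t * ξ i) := by
      rw [Filter.eventually_all_finset]
      intro m hm
      have hc := (Sfun_hasDerivAt α (m : ℤ) x ξ 0).continuousAt
      refine hc.eventually (lt_mem_nhds ?_)
      beta_reduce; rw [z, Sfun_eq]
      exact hx m (by have := Finset.mem_range.mp hm; omega)
    filter_upwards [this] with t ht m hm
    rw [← Sfun_eq]
    exact ht m (Finset.mem_range.mpr (by omega))
  have hneg : Tendsto (fun t : ℝ => -t) (𝓝 0) (𝓝 0) := by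
    simpa using (continuous_neg.tendsto (0 : ℝ))
  have p0 := hx j (by omega)
  have p1 := hx (j + 1) (by omega)
  rw [← Sfun_eq] at p0 p1
  have key := quot_second
    (N := fun t => Sfun α ((j + 1 : ℕ) : ℤ) (fun i => x i + t * ξ i))
    (P := fun t => Sfun α (j : ℤ) (fun i => x i + t * ξ i))
    (fun t => Sfun_hasDerivAt α _ x ξ t) (Sprime_hasDerivAt α _ x ξ 0)
    (fun t => Sfun_hasDerivAt α _ x ξ t) (Sprime_hasDerivAt α _ x ξ 0)
    (by simpa only [z] using p0) (by simpa only [z] using p1) ?_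
  · simpa only [z] using key
  · filter_upwards [hcone, hneg.eventually hcone] with t h1 h2
    have h3 := (quot_superadd j (TT n) _ _ h1 h2).2
    have e : (fun i => extVec α (fun i => x i + t * ξ i) i + extVec α (fun i => x i + -t * ξ i) i)
        = fun i => 2 * extVec α x i := by
      funext i
      cases i <;> simp [extVec] <;> ring
    rw [e, es_smul, es_smul] at h3
    simp only [z]
    simp only [← Sfun_eq] at h3
    refine h3.trans (le_of_eq ?_)
    rw [pow_succ]
    field_simp

theorem tele (n k l : ℕ) (hlk : l < k) (α : ℝ) (x ξ : Fin n → ℝ)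
    (hx : Gam (TT n) k (extVec α x)) :
    (Sprime α (k : ℤ) x ξ / Sfun α (k : ℤ) x - Sprime α (l : ℤ) x ξ / Sfun α (l : ℤ) x) ^ 2
        / ((k : ℝ) - l)
      ≤ -(Qform α (k : ℤ) x ξ / Sfun α (k : ℤ) x) + (Sprime α (k : ℤ) x ξ / Sfun α (k : ℤ) x) ^ 2
        + Qform α (l : ℤ) x ξ / Sfun α (l : ℤ) x
        - (Sprime α (l : ℤ) x ξ / Sfun α (l : ℤ) x) ^ 2 := by
  induction k, hlk using Nat.le_induction with
  | base =>
    have h := step_ineq α x ξ l hx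
    rw [show ((l.succ : ℕ) : ℝ) - l = 1 by push_cast; ring, div_one]
    simp only [Nat.succ_eq_add_one]
    linarith
  | succ k hk ih =>
    have h := step_ineq α x ξ k hx
    have h0 := ih (hx.mono (by omega))
    have hm : (0 : ℝ) < (k : ℝ) - l := by
      have : (l : ℝ) < k := by exact_mod_cast hk
      linarith
    generalize Sprime α ((k + 1 : ℕ) : ℤ) x ξ / Sfun α ((k + 1 : ℕ) : ℤ) x = c at *
    generalize Sprime α (k : ℤ) x ξ / Sfun α (k : ℤ) x = b at *
    generalize Sprime α (l : ℤ) x ξ / Sfun α (l : ℤ) x = a at *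
    have h4 := sq_div_add_le (a := b - a) (b := c - b) hm one_pos
    rw [show b - a + (c - b) = c - a by ring, div_one,
      show (k : ℝ) - l + 1 = ((k + 1 : ℕ) : ℝ) - l by push_cast; ring] at h4
    linarith

theorem gam_of_tilde {n k : ℕ} {α : ℝ} (hk : 1 ≤ k) (hα : 0 < α) {x : Fin n → ℝ}
    (h : x ∈ GammaTilde n k α) : Gam (TT n) k (extVec α x) := by
  intro i hi
  rw [← Sfun_eq]
  have pos : ∀ m : ℕ, m ≤ k - 1 → 0 < esymmR (m : ℤ) x := by
    intro m hm
    rcases Nat.eq_zero_or_pos m with rfl | h0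
    · have : esymmR ((0 : ℕ) : ℤ) x = 1 := es_zero _ _
      rw [this]; norm_num
    · exact h.1 m h0 hm
  rcases Nat.lt_or_ge i k with hlt | hge
  · unfold Sfun
    have h1 := pos i (by omega)
    rcases Nat.eq_zero_or_pos i with rfl | h0
    · have : esymmR (((0 : ℕ) : ℤ) - 1) x = 0 := es_neg _ _ (by norm_num) _
      rw [this]; linarith
    · have h2 := pos (i - 1) (by omega)
      rw [show ((i - 1 : ℕ) : ℤ) = (i : ℤ) - 1 by omega] at h2
      have := mul_pos hα h2
      linarith
  · obtain rfl : i = k := by omega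
    exact h.2

/-- **Quotient-concavity inequalities** (Lemma 2.3 (e)): for `1 ≤ l < k ≤ n`,
`τ = 1/(k-l)`, `λ ∈ Γ̃_k` and any `ξ ∈ ℝⁿ`, one has
(i) `-Q_k/S_k + Q_l/S_l ≥ (S_k'/S_k - S_l'/S_l)((τ-1)S_k'/S_k - (τ+1)S_l'/S_l)`, and
(ii) for every `δ > 0`,
`-Q_k + (1-τ+τ/δ)(S_k')²/S_k ≥ S_k (1+τ-δτ)(S_l'/S_l)² - (S_k/S_l) Q_l`. -/
theorem quotient_concavity_inequalities
    {n k l : ℕ} (hl : 1 ≤ l) (hlk : l < k) (hkn : k ≤ n) (α : ℝ) (hα : 0 < α)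
    (τ : ℝ) (hτ : τ = 1 / ((k : ℝ) - (l : ℝ)))
    (lam : Fin n → ℝ) (hlam : lam ∈ GammaTilde n k α) (ξ : Fin n → ℝ) :
    (-(Qform α (k : ℤ) lam ξ) / Sfun α (k : ℤ) lam
        + Qform α (l : ℤ) lam ξ / Sfun α (l : ℤ) lam
      ≥ (Sprime α (k : ℤ) lam ξ / Sfun α (k : ℤ) lam
            - Sprime α (l : ℤ) lam ξ / Sfun α (l : ℤ) lam)
          * ((τ - 1) * (Sprime α (k : ℤ) lam ξ / Sfun α (k : ℤ) lam)
            - (τ + 1) * (Sprime α (l : ℤ) lam ξ / Sfun α (l : ℤ) lam))) ∧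
    (∀ δ : ℝ, 0 < δ →
      -(Qform α (k : ℤ) lam ξ)
          + (1 - τ + τ / δ) * (Sprime α (k : ℤ) lam ξ) ^ 2 / Sfun α (k : ℤ) lam
        ≥ Sfun α (k : ℤ) lam * (1 + τ - δ * τ)
              * (Sprime α (l : ℤ) lam ξ / Sfun α (l : ℤ) lam) ^ 2
            - (Sfun α (k : ℤ) lam / Sfun α (l : ℤ) lam) * Qform α (l : ℤ) lam ξ) := by
  have hG := gam_of_tilde (by omega) hα hlam
  have hk0 : 0 < Sfun α (k : ℤ) lam := by rw [Sfun_eq]; exact hG k le_rfl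
  have hl0 : 0 < Sfun α (l : ℤ) lam := by rw [Sfun_eq]; exact hG l hlk.le
  have ht := tele n k l hlk α lam ξ hG
  have hτ0 : 0 < τ := by
    rw [hτ]
    have : (l : ℝ) < k := by exact_mod_cast hlk
    exact one_div_pos.mpr (by linarith)
  rw [div_eq_mul_one_div, ← hτ] at ht
  generalize Sfun α (k : ℤ) lam = sk at *
  generalize Sfun α (l : ℤ) lam = sl at *
  generalize Qform α (k : ℤ) lam ξ = qk at *
  generalize Qform α (l : ℤ) lam ξ = ql at *
  generalize Sprime α (k : ℤ) lam ξ = a' at *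
  generalize Sprime α (l : ℤ) lam ξ = b' at *
  obtain ⟨a, rfl⟩ : ∃ a, a' = a * sk := ⟨a' / sk, by field_simp⟩
  obtain ⟨b, rfl⟩ : ∃ b, b' = b * sl := ⟨b' / sl, by field_simp⟩
  obtain ⟨u, rfl⟩ : ∃ u, qk = u * sk := ⟨qk / sk, by field_simp⟩
  obtain ⟨v, rfl⟩ : ∃ v, ql = v * sl := ⟨ql / sl, by field_simp⟩
  rw [mul_div_cancel_right₀ _ hk0.ne', mul_div_cancel_right₀ _ hk0.ne',
    mul_div_cancel_right₀ _ hl0.ne', mul_div_cancel_right₀ _ hl0.ne'] at ht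
  constructor
  · rw [neg_div, mul_div_cancel_right₀ _ hk0.ne', mul_div_cancel_right₀ _ hk0.ne',
      mul_div_cancel_right₀ _ hl0.ne', mul_div_cancel_right₀ _ hl0.ne']
    nlinarith
  · intro δ hδ
    rw [mul_div_cancel_right₀ _ hl0.ne']
    have e1 : (1 - τ + τ / δ) * (a * sk) ^ 2 / sk = (1 - τ + τ / δ) * a ^ 2 * sk := by
      field_simp
    have e2 : sk / sl * (v * sl) = sk * v := by field_simp
    rw [e1, e2]
    have h1 : 0 ≤ τ / δ * (a - δ * b) ^ 2 := by positivity
    have h2 : τ / δ * (a - δ * b) ^ 2 = τ / δ * a ^ 2 - 2 * τ * a * b + δ * τ * b ^ 2 := by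
      field_simp
      ring
    rw [h2] at h1
    have h3 : 0 ≤ sk * (-u + (1 - τ + τ / δ) * a ^ 2 - (1 + τ - δ * τ) * b ^ 2 + v) := by
      apply mul_nonneg hk0.le
      nlinarith
    nlinarith
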